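/- Summation counting estimate (Lemma 3.5): Let k ≥ 3 be an integer, 1 < α ≤ 3/2, and s ≥ α − 1. For every choice of signs ε_sum, ε_1, …, ε_k ∈ {−1, +1} there exists a constant C = C(k, α, s) > 0 such that for all dyadic numbers N_1, …, N_k ≥ 1 and every ζ ∈ ℝ, Σ_{n_1, …, n_k ∈ ℤ³} [ (Π_{j=1}^k 1_{|n_j| ∼ N_j} ⟪n_j⟫^{−2}) · ⟨Σ_{j=1}^k n_j⟩^{2(s−α)} · 1_{|κ(n_1,…,n_k) − ζ| ≤ 1} ] ≤ C · N_max^{(k−3)(3−2α) + 2s − 6α + 6}, where N_max = max(N_1, …, N_k). -/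

import Mathlib

noncomputable section

open scoped BigOperators

/-- Japanese bracket of a real number: `⟨x⟩ = (1 + x²)^{1/2}`. -/
def rjb (x : ℝ) : ℝ := Real.sqrt (1 + x ^ 2)

/-- Euclidean norm of a lattice point in `ℤ³`. -/
def znorm (n : Fin 3 → ℤ) : ℝ := Real.sqrt (∑ i, ((n i : ℝ)) ^ 2)

/-- Japanese bracket `⟨n⟩ = (1 + |n|²)^{1/2}` of a lattice point in `ℤ³`. -/
def jb (n : Fin 3 → ℤ) : ℝ := Real.sqrt (1 + ∑ i, ((n i : ℝ)) ^ 2)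

/-- The modified bracket `⟪n⟫ = (⟨n⟩^{2α} − 1/4)^{1/2}`. -/
def jbb (α : ℝ) (n : Fin 3 → ℤ) : ℝ := Real.sqrt (jb n ^ (2 * α) - 1 / 4)

/-- Dyadic numbers `2^j`, `j ≥ 0`. -/
def IsDyadic (N : ℝ) : Prop := ∃ j : ℕ, N = 2 ^ j

/-- `|n| ∼ N` for a dyadic number `N`: `N/2 < |n| ≤ N` if `N ≥ 2`, and `|n| ≤ 1` if `N = 1`. -/
def SimFreq (N : ℝ) (n : Fin 3 → ℤ) : Prop :=
  (2 ≤ N ∧ N / 2 < znorm n ∧ znorm n ≤ N) ∨ (N < 2 ∧ znorm n ≤ 1)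

/-- `x` is a sign `±1`. -/
def IsSign (x : ℝ) : Prop := x = 1 ∨ x = -1

open Classical in
/-- Real-valued indicator of a proposition. -/
def ind (p : Prop) : ℝ := if p then 1 else 0

/-- The phase `κ(n₁,…,n_k) = ε_sum ⟪n₁+⋯+n_k⟫ + Σ_j ε_j ⟪n_j⟫`. -/
def phase (α : ℝ) {k : ℕ} (εsum : ℝ) (ε : Fin k → ℝ) (n : Fin k → Fin 3 → ℤ) : ℝ :=
  εsum * jbb α (∑ j, n j) + ∑ j, ε j * jbb α (n j)

open MeasureTheory

/-- A planar annulus has area at most `π` times the increment of the squared radius. -/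
theorem volume_annulus_le (A B : ℝ) (hAB : A ≤ B) :
    volume {y : Fin 2 → ℝ | A ≤ y 0 ^ 2 + y 1 ^ 2 ∧ y 0 ^ 2 + y 1 ^ 2 ≤ B}
      ≤ ENNReal.ofReal (Real.pi * (B - A)) := by
  have hsub : (WithLp.ofLp : EuclideanSpace ℝ (Fin 2) → (Fin 2 → ℝ)) ⁻¹'
      {y : Fin 2 → ℝ | A ≤ y 0 ^ 2 + y 1 ^ 2 ∧ y 0 ^ 2 + y 1 ^ 2 ≤ B}
      ⊆ Metric.closedBall 0 (Real.sqrt B) \ Metric.ball 0 (Real.sqrt A) := by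
    intro y hy
    simp only [Set.mem_preimage, Set.mem_ofPred_eq] at hy
    have hn : ‖y‖ = Real.sqrt (y 0 ^ 2 + y 1 ^ 2) := by
      rw [EuclideanSpace.norm_eq]; simp [Fin.sum_univ_two]
    simp only [Set.mem_sdiff, Metric.mem_closedBall, Metric.mem_ball, dist_zero_right, not_lt, hn]
    exact ⟨Real.sqrt_le_sqrt hy.2, Real.sqrt_le_sqrt hy.1⟩
  have hmeas : MeasurableSet {y : Fin 2 → ℝ | A ≤ y 0 ^ 2 + y 1 ^ 2 ∧ y 0 ^ 2 + y 1 ^ 2 ≤ B} := by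
    have h : Measurable fun y : Fin 2 → ℝ => y 0 ^ 2 + y 1 ^ 2 := by fun_prop
    exact (measurableSet_le measurable_const h).inter (measurableSet_le h measurable_const)
  rw [← (PiLp.volume_preserving_ofLp (Fin 2)).measure_preimage hmeas.nullMeasurableSet]
  refine (measure_mono hsub).trans ?_
  have hs : Real.sqrt A ≤ Real.sqrt B := Real.sqrt_le_sqrt hAB
  rw [measure_sdiff ((Metric.ball_subset_closedBall).trans (Metric.closedBall_subset_closedBall hs))
    Metric.isOpen_ball.measurableSet.nullMeasurableSet measure_ball_lt_top.ne,
    EuclideanSpace.volume_ball_fin_two, EuclideanSpace.volume_closedBall_fin_two]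
  have key : ∀ r : ℝ, 0 ≤ r → ENNReal.ofReal r ^ 2 * ENNReal.ofReal Real.pi
      = ENNReal.ofReal (Real.pi * r ^ 2) := by
    intro r hr
    rw [mul_comm Real.pi, ENNReal.ofReal_mul (by positivity), ENNReal.ofReal_pow hr]
  rw [key _ (Real.sqrt_nonneg _), key _ (Real.sqrt_nonneg _),
    ← ENNReal.ofReal_sub _ (by positivity)]
  apply ENNReal.ofReal_le_ofReal
  rw [← mul_sub]
  refine mul_le_mul_of_nonneg_left ?_ Real.pi_pos.le
  rcases le_total 0 A with hA | hA
  · rw [Real.sq_sqrt hA, Real.sq_sqrt (hA.trans hAB)]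
  · rw [Real.sqrt_eq_zero_of_nonpos hA]
    rcases le_total 0 B with hB | hB
    · rw [Real.sq_sqrt hB]; linarith
    · rw [Real.sqrt_eq_zero_of_nonpos hB]; linarith

/-- Archimedes' hat-box bound: volume of the part of a spherical shell inside a slab. -/
theorem volume_shell_inter_slab_le (e : EuclideanSpace ℝ (Fin 3)) (he : ‖e‖ = 1)
    (A B b c : ℝ) (hAB : A ≤ B) :
    volume {x : EuclideanSpace ℝ (Fin 3) |
        (A ≤ ‖x‖ ^ 2 ∧ ‖x‖ ^ 2 ≤ B) ∧ inner ℝ e x ∈ Set.Icc b c}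
      ≤ ENNReal.ofReal (Real.pi * (B - A)) * ENNReal.ofReal (c - b) := by
  obtain ⟨bas, hbas⟩ := Orthonormal.exists_orthonormalBasis_extension_of_card_eq
    (𝕜 := ℝ) (E := EuclideanSpace ℝ (Fin 3)) (ι := Fin 3) (by simp) (v := fun _ => e) (s := {0})
    (by
      rw [orthonormal_iff_ite]
      rintro ⟨i, hi⟩ ⟨j, hj⟩
      simp only [Set.mem_singleton_iff] at hi hj
      subst hi hj
      simp [he])
  have hb0 : bas 0 = e := hbas 0 (by simp)
  set T : Set (ℝ × (Fin 2 → ℝ)) := {p | (A - p.1 ^ 2 ≤ p.2 0 ^ 2 + p.2 1 ^ 2 ∧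
    p.2 0 ^ 2 + p.2 1 ^ 2 ≤ B - p.1 ^ 2) ∧ p.1 ∈ Set.Icc b c} with hT
  have hTm : MeasurableSet T := by
    have h : Measurable fun p : ℝ × (Fin 2 → ℝ) => p.2 0 ^ 2 + p.2 1 ^ 2 := by fun_prop
    have h' : ∀ D : ℝ, Measurable fun p : ℝ × (Fin 2 → ℝ) => D - p.1 ^ 2 := by
      intro D; fun_prop
    exact ((measurableSet_le (h' A) h).inter (measurableSet_le h (h' B))).inter
      (measurable_fst measurableSet_Icc)
  have mp := ((volume_preserving_piFinSuccAbove (fun _ : Fin 3 => ℝ) 0).comp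
    (PiLp.volume_preserving_ofLp (Fin 3))).comp bas.measurePreserving_repr
  have hset : {x : EuclideanSpace ℝ (Fin 3) |
        (A ≤ ‖x‖ ^ 2 ∧ ‖x‖ ^ 2 ≤ B) ∧ inner ℝ e x ∈ Set.Icc b c}
      = ((MeasurableEquiv.piFinSuccAbove (fun _ : Fin 3 => ℝ) 0 ∘ WithLp.ofLp) ∘ bas.repr) ⁻¹' T := by
    ext x
    have h0 : inner ℝ e x = bas.repr x 0 := by rw [bas.repr_apply_apply, hb0]
    have hn : ‖x‖ ^ 2 = bas.repr x 0 ^ 2 + (bas.repr x 1 ^ 2 + bas.repr x 2 ^ 2) := by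
      rw [← bas.repr.norm_map x, EuclideanSpace.norm_sq_eq]
      simp [Fin.sum_univ_three, add_assoc]
    simp only [Set.mem_ofPred_eq, h0, hn, Set.mem_preimage, hT, Function.comp]
    have e0 : (MeasurableEquiv.piFinSuccAbove (fun _ : Fin 3 => ℝ) 0 (bas.repr x).ofLp).1
      = bas.repr x 0 := rfl
    have e1 : (MeasurableEquiv.piFinSuccAbove (fun _ : Fin 3 => ℝ) 0 (bas.repr x).ofLp).2 0
      = bas.repr x 1 := rfl
    have e2 : (MeasurableEquiv.piFinSuccAbove (fun _ : Fin 3 => ℝ) 0 (bas.repr x).ofLp).2 1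
      = bas.repr x 2 := rfl
    rw [e0, e1, e2]
    refine and_congr_left' (and_congr ⟨fun h => by linarith, fun h => by linarith⟩
      ⟨fun h => by linarith, fun h => by linarith⟩)
  rw [hset, mp.measure_preimage hTm.nullMeasurableSet, Measure.volume_eq_prod,
    Measure.prod_apply hTm]
  calc ∫⁻ t, volume (Prod.mk t ⁻¹' T)
      ≤ ∫⁻ t, (Set.Icc b c).indicator (fun _ => ENNReal.ofReal (Real.pi * (B - A))) t := by
        apply lintegral_mono
        intro t
        by_cases ht : t ∈ Set.Icc b c
        · simp only [Set.indicator_of_mem ht]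
          have := volume_annulus_le (A - t ^ 2) (B - t ^ 2) (by linarith)
          rw [show B - t ^ 2 - (A - t ^ 2) = B - A by ring] at this
          refine le_trans (measure_mono ?_) this
          intro y hy
          exact hy.1
        · have : Prod.mk t ⁻¹' T = ∅ := by
            ext y
            simp only [Set.mem_preimage, hT, Set.mem_ofPred_eq, Set.mem_empty_iff_false, iff_false]
            exact fun h => ht h.2
          simp [this]
    _ = _ := by
        rw [lintegral_indicator measurableSet_Icc, setLIntegral_const, Real.volume_Icc]

/-- A lattice point seen as a vector of Euclidean space. -/
def toE (n : Fin 3 → ℤ) : EuclideanSpace ℝ (Fin 3) := WithLp.toLp 2 (fun i => (n i : ℝ))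

theorem toE_sub (m n : Fin 3 → ℤ) : toE (m - n) = toE m - toE n := by
  ext i; simp [toE]

theorem toE_add (m n : Fin 3 → ℤ) : toE (m + n) = toE m + toE n := by
  ext i; simp [toE]

theorem znorm_eq_norm (n : Fin 3 → ℤ) : znorm n = ‖toE n‖ := by
  rw [znorm, EuclideanSpace.norm_eq]; simp [toE]

theorem jb_sq (n : Fin 3 → ℤ) : jb n ^ 2 = 1 + ‖toE n‖ ^ 2 := by
  rw [jb, Real.sq_sqrt (by positivity), EuclideanSpace.norm_sq_eq]; simp [toE]

theorem one_le_jb (n : Fin 3 → ℤ) : 1 ≤ jb n := by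
  rw [jb]; apply Real.one_le_sqrt.mpr
  have : 0 ≤ ∑ i, ((n i : ℝ)) ^ 2 := by positivity
  linarith

theorem norm_toE_le_jb (n : Fin 3 → ℤ) : ‖toE n‖ ≤ jb n := by
  have := jb_sq n; have := one_le_jb n; nlinarith [norm_nonneg (toE n)]

theorem jb_le_one_add_norm (n : Fin 3 → ℤ) : jb n ≤ 1 + ‖toE n‖ := by
  have := jb_sq n; have := one_le_jb n; nlinarith [norm_nonneg (toE n)]

theorem jb_add_le (m n : Fin 3 → ℤ) : jb (m + n) ≤ jb m + ‖toE n‖ := by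
  have h1 := jb_sq (m + n)
  have h2 := jb_sq m
  have h3 := norm_toE_le_jb m
  have h4 : ‖toE (m + n)‖ ≤ ‖toE m‖ + ‖toE n‖ := by rw [toE_add]; exact norm_add_le _ _
  have h5 := one_le_jb m
  have h6 := norm_nonneg (toE n)
  have h7 := norm_nonneg (toE (m + n))
  have h8 : ‖toE (m + n)‖ ^ 2 ≤ (‖toE m‖ + ‖toE n‖) ^ 2 := by gcongr
  refine (pow_le_pow_iff_left₀ (by linarith [one_le_jb (m + n)]) (by positivity) two_ne_zero).mp ?_
  nlinarith [mul_le_mul_of_nonneg_right h3 h6]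

theorem one_le_norm_toE {n : Fin 3 → ℤ} (hn : n ≠ 0) : 1 ≤ ‖toE n‖ := by
  obtain ⟨i, hi⟩ := Function.ne_iff.mp hn
  have h1 : (1 : ℝ) ≤ |(n i : ℝ)| := by exact_mod_cast Int.one_le_abs hi
  have h2 : ‖toE n i‖ ≤ ‖toE n‖ := PiLp.norm_apply_le _ i
  exact h1.trans h2

/-- Lattice points in the intersection of a unit-width shell and a slab. -/
theorem card_shell_inter_slab_le (S : Finset (Fin 3 → ℤ)) (e : EuclideanSpace ℝ (Fin 3))
    (he : ‖e‖ = 1) (r b h : ℝ) (hr : 1 ≤ r) (hh : 1 ≤ h)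
    (hS : ∀ l ∈ S, (r ≤ jb l ∧ jb l ≤ r + 1) ∧ (b ≤ inner ℝ e (toE l) ∧ inner ℝ e (toE l) ≤ b + h)) :
    (S.card : ℝ) ≤ 108 * r * h := by
  set A : ℝ := (max (r - 2) 0) ^ 2 with hA
  set B : ℝ := (r + 2) ^ 2 with hB
  have hA0 : 0 ≤ max (r - 2) 0 := le_max_right _ _
  have hA1 : r - 2 ≤ max (r - 2) 0 := le_max_left _ _
  have hBA : B - A ≤ 9 * r := by
    rcases le_total r 2 with h2 | h2
    · rw [hA, hB, max_eq_right (by linarith)]; nlinarith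
    · rw [hA, hB, max_eq_left (by linarith)]; nlinarith
  have hAB : A ≤ B := by
    have : max (r - 2) 0 ≤ r + 2 := max_le (by linarith) (by linarith)
    rw [hA, hB]; gcongr
  have hvol := volume_shell_inter_slab_le e he A B (b - 1 / 2) (b + h + 1 / 2) hAB
  have hdisj : (S : Set (Fin 3 → ℤ)).PairwiseDisjoint (fun l => Metric.ball (toE l) (1 / 2)) := by
    intro l _ l' _ hll
    apply Metric.ball_disjoint_ball
    rw [dist_eq_norm, ← toE_sub]
    have := one_le_norm_toE (sub_ne_zero.mpr hll)
    linarith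
  have hsub : (⋃ l ∈ S, Metric.ball (toE l) (1 / 2)) ⊆ {x : EuclideanSpace ℝ (Fin 3) |
        (A ≤ ‖x‖ ^ 2 ∧ ‖x‖ ^ 2 ≤ B) ∧ inner ℝ e x ∈ Set.Icc (b - 1 / 2) (b + h + 1 / 2)} := by
    intro x hx
    simp only [Set.mem_iUnion, Metric.mem_ball, exists_prop] at hx
    obtain ⟨l, hl, hx⟩ := hx
    rw [dist_eq_norm] at hx
    obtain ⟨⟨h1, h2⟩, h3, h4⟩ := hS l hl
    have h5 := norm_toE_le_jb l
    have h6 := jb_le_one_add_norm l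
    have h7 : ‖x‖ ≤ ‖toE l‖ + ‖x - toE l‖ := by
      simpa using norm_add_le (toE l) (x - toE l)
    have h8 : ‖toE l‖ ≤ ‖x‖ + ‖x - toE l‖ := by
      simpa using norm_sub_le x (x - toE l)
    have h9 : |inner ℝ e x - inner ℝ e (toE l)| ≤ ‖x - toE l‖ := by
      rw [← inner_sub_right]
      simpa [he] using abs_real_inner_le_norm e (x - toE l)
    have h10 := abs_le.mp h9
    refine ⟨⟨?_, ?_⟩, ?_, ?_⟩
    · rw [hA]; gcongr; exact max_le (by linarith) (norm_nonneg x)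
    · rw [hB]; gcongr; linarith
    · linarith [h10.1]
    · linarith [h10.2]
  have hun := measure_biUnion_finset (μ := volume) hdisj
    (fun l _ => Metric.isOpen_ball.measurableSet)
  have hle := (measure_mono hsub).trans hvol
  rw [hun] at hle
  simp only [EuclideanSpace.volume_ball_fin_three, Finset.sum_const, nsmul_eq_mul] at hle
  have hpi := Real.pi_pos
  rw [← ENNReal.ofReal_mul (mul_nonneg hpi.le (by linarith)), ← ENNReal.ofReal_natCast,
    ← ENNReal.ofReal_pow (by norm_num),
    ← ENNReal.ofReal_mul (by positivity), ← ENNReal.ofReal_mul (by positivity),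
    ENNReal.ofReal_le_ofReal_iff (mul_nonneg (mul_nonneg hpi.le (by linarith)) (by linarith))] at hle
  have h1 : (S.card : ℝ) ≤ 6 * ((B - A) * (h + 1)) := by
    have : Real.pi * S.card ≤ Real.pi * (6 * ((B - A) * (h + 1))) := by linarith
    exact le_of_mul_le_mul_left this hpi
  have h2 : (B - A) * (h + 1) ≤ 9 * r * (2 * h) := by
    apply mul_le_mul hBA (by linarith) (by linarith) (by linarith)
  linarith

theorem jbb_sq {α : ℝ} (hα : 1 < α) (n : Fin 3 → ℤ) :
    jbb α n ^ 2 = (jb n ^ (α - 1) * jb n) ^ 2 - 1 / 4 ∧ 1 ≤ jb n ^ (α - 1) := by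
  have h1 := one_le_jb n
  have h0 : 0 < jb n := by linarith
  have hP : 1 ≤ jb n ^ (α - 1) := Real.one_le_rpow h1 (by linarith)
  have hpow : jb n ^ (2 * α) = (jb n ^ (α - 1) * jb n) ^ 2 := by
    rw [← Real.rpow_add_one h0.ne', ← Real.rpow_natCast, ← Real.rpow_mul h0.le]
    congr 1; push_cast; ring
  refine ⟨?_, hP⟩
  rw [jbb, hpow, Real.sq_sqrt]
  have : 1 ≤ jb n ^ (α - 1) * jb n := by nlinarith
  nlinarith

theorem jbb_nonneg (α : ℝ) (n : Fin 3 → ℤ) : 0 ≤ jbb α n := Real.sqrt_nonneg _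

theorem jbb_bounds {α : ℝ} (hα : 1 < α) (n : Fin 3 → ℤ) :
    jb n ^ (α - 1) * jb n / 2 ≤ jbb α n ∧ jbb α n ≤ jb n ^ (α - 1) * jb n := by
  obtain ⟨h, hP⟩ := jbb_sq hα n
  have h1 := one_le_jb n
  have h2 := jbb_nonneg α n
  have h3 : 1 ≤ jb n ^ (α - 1) * jb n := by nlinarith
  constructor <;> nlinarith

/-- On a unit-width shell the modified bracket varies by at most `O(⟨n⟩^{α-1})`. -/
theorem jbb_sub_le {α : ℝ} (hα : 1 < α) (hα' : α ≤ 2) {m n : Fin 3 → ℤ}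
    (hnm : jb n ≤ jb m) (hmn : jb m ≤ jb n + 1) :
    jbb α m - jbb α n ≤ 8 * jb m ^ (α - 1) := by
  obtain ⟨hm, hP⟩ := jbb_sq hα m
  obtain ⟨hn, hQ⟩ := jbb_sq hα n
  have hlow := (jbb_bounds hα m).1
  have hu := jbb_nonneg α m
  have hv := jbb_nonneg α n
  have hb := one_le_jb n
  have ha := one_le_jb m
  have hQP : jb n ^ (α - 1) ≤ jb m ^ (α - 1) :=
    Real.rpow_le_rpow (by linarith) hnm (by linarith)
  have hcmp : jb m ^ (α - 1) * jb n ≤ jb n ^ (α - 1) * jb m := by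
    have h1 : (jb n / jb m) ^ (1 : ℝ) ≤ (jb n / jb m) ^ (α - 1) :=
      Real.rpow_le_rpow_of_exponent_ge (by positivity) (by rw [div_le_one (by linarith)]; exact hnm)
        (by linarith)
    rw [Real.rpow_one, Real.div_rpow (by linarith) (by linarith),
      div_le_div_iff₀ (by linarith) (by linarith)] at h1
    linarith
  set P := jb m ^ (α - 1)
  set Q := jb n ^ (α - 1)
  set a := jb m
  set b := jb n
  set u := jbb α m
  set v := jbb α n
  have h1 : P * a - Q * b ≤ 2 * P := by
    have h2 : (P * a - Q * b) * a ≤ 2 * P * a := by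
      have : P * b * b ≤ Q * a * b := by gcongr
      have h3 : P * (a ^ 2 - b ^ 2) ≤ P * (2 * a) := by
        gcongr; nlinarith
      nlinarith
    exact le_of_mul_le_mul_right h2 (by linarith)
  have h2 : P * b ≤ P * a := by gcongr
  have h3 : Q * b ≤ P * a := by
    calc Q * b ≤ P * b := by gcongr
      _ ≤ _ := h2
  have h4 : (u - v) * (u + v) ≤ 2 * P * (2 * (P * a)) := by
    calc (u - v) * (u + v) = (P * a - Q * b) * (P * a + Q * b) := by ring_nf; ring_nf at hm hn; linarith
      _ ≤ 2 * P * (2 * (P * a)) := by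
        apply mul_le_mul h1 (by linarith) (by positivity) (by positivity)
  by_contra hcon
  push Not at hcon
  have hPa : 0 < P * a := by positivity
  have h5 : 8 * P * (P * a / 2) < (u - v) * (u + v) := by
    calc 8 * P * (P * a / 2) < (u - v) * (P * a / 2) := by gcongr
      _ ≤ (u - v) * (u + v) := by
        apply mul_le_mul_of_nonneg_left (by linarith)
        have : 0 ≤ 8 * P := by positivity
        linarith
  linarith

/-- A bound on the variation of the modified bracket controls the variation of `⟨n⟩²`. -/
theorem jb_sq_sub_le {α N D : ℝ} (hα : 1 < α) (hα' : α ≤ 2) (hN : 1 ≤ N) (hD : 0 ≤ D)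
    {m n : Fin 3 → ℤ} (hn : N / 2 ≤ jb n) (hnm : jb n ≤ jb m) (hm : jb m ≤ 2 * N)
    (h : jbb α m - jbb α n ≤ D * N ^ (α - 1)) :
    jb m ^ 2 - jb n ^ 2 ≤ 32 * D * N := by
  obtain ⟨hm2, hP⟩ := jbb_sq hα m
  obtain ⟨hn2, hQ⟩ := jbb_sq hα n
  have hum := (jbb_bounds hα m).2
  have hun := (jbb_bounds hα n).2
  have hu := jbb_nonneg α m
  have hv := jbb_nonneg α n
  have hb := one_le_jb n
  have ha := one_le_jb m
  have hV : 1 ≤ N ^ (α - 1) := Real.one_le_rpow hN (by linarith)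
  have hQP : jb n ^ (α - 1) ≤ jb m ^ (α - 1) :=
    Real.rpow_le_rpow (by linarith) hnm (by linarith)
  have h2le : (2 : ℝ) ^ (α - 1) ≤ 2 := by
    calc (2 : ℝ) ^ (α - 1) ≤ 2 ^ (1 : ℝ) :=
          Real.rpow_le_rpow_of_exponent_le (by norm_num) (by linarith)
      _ = 2 := Real.rpow_one 2
  have hPV : jb m ^ (α - 1) ≤ 2 * N ^ (α - 1) := by
    calc jb m ^ (α - 1) ≤ (2 * N) ^ (α - 1) := Real.rpow_le_rpow (by linarith) hm (by linarith)
      _ = 2 ^ (α - 1) * N ^ (α - 1) := Real.mul_rpow (by norm_num) (by linarith)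
      _ ≤ _ := by gcongr
  have hQV : N ^ (α - 1) / 2 ≤ jb n ^ (α - 1) := by
    calc N ^ (α - 1) / 2 ≤ N ^ (α - 1) / 2 ^ (α - 1) := by gcongr
      _ = (N / 2) ^ (α - 1) := (Real.div_rpow (by linarith) (by norm_num) _).symm
      _ ≤ _ := Real.rpow_le_rpow (by linarith) hn (by linarith)
  set P := jb m ^ (α - 1)
  set Q := jb n ^ (α - 1)
  set a := jb m
  set b := jb n
  set u := jbb α m
  set v := jbb α n
  set V := N ^ (α - 1)
  have h3 : Q * b ≤ P * a := by
    calc Q * b ≤ P * b := by gcongr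
      _ ≤ P * a := by gcongr
  have hab : 0 ≤ a ^ 2 - b ^ 2 := by nlinarith
  have h4 : Q ^ 2 * (a ^ 2 - b ^ 2) ≤ (u - v) * (u + v) := by
    have : Q ^ 2 * a ^ 2 ≤ P ^ 2 * a ^ 2 := by gcongr
    nlinarith
  have h5 : (u - v) * (u + v) ≤ D * V * (2 * (2 * V * (2 * N))) := by
    calc (u - v) * (u + v) ≤ D * V * (u + v) := by gcongr
      _ ≤ D * V * (2 * (2 * V * (2 * N))) := by
        gcongr
        have : P * a ≤ 2 * V * (2 * N) := by gcongr
        linarith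
  have h6 : (V / 2) ^ 2 * (a ^ 2 - b ^ 2) ≤ Q ^ 2 * (a ^ 2 - b ^ 2) := by gcongr
  have h7 : V ^ 2 * (a ^ 2 - b ^ 2) ≤ V ^ 2 * (32 * D * N) := by nlinarith
  exact le_of_mul_le_mul_left h7 (by positivity)

theorem abs_sub_le_of_isSign {σ τ u u' v v' ζ D : ℝ} (hσ : IsSign σ) (hτ : IsSign τ)
    (h : |σ * u + τ * v - ζ| ≤ 1) (h' : |σ * u' + τ * v' - ζ| ≤ 1) (hu : |u - u'| ≤ D) :
    |v - v'| ≤ D + 2 := by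
  rw [abs_le] at *
  rcases hσ with rfl | rfl <;> rcases hτ with rfl | rfl <;> constructor <;> linarith

/-- Lattice points on a level set of the two-centre phase, within a unit-width shell. -/
theorem card_shell_inter_level_le {α K N r : ℝ} (hα : 1 < α) (hα' : α ≤ 2) (hK : 0 ≤ K)
    (hN : 1 ≤ N) (hr : 1 ≤ r) {σ τ ζ : ℝ} (hσ : IsSign σ) (hτ : IsSign τ)
    {m : Fin 3 → ℤ} (hm0 : m ≠ 0) (hm : ‖toE m‖ ≤ K * N) (S : Finset (Fin 3 → ℤ))
    (hS : ∀ n ∈ S, (N / 2 ≤ jb n ∧ jb n ≤ 2 * N) ∧ (r ≤ jb (n + m) ∧ jb (n + m) ≤ r + 1) ∧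
      |σ * jbb α (n + m) + τ * jbb α n - ζ| ≤ 1) :
    (S.card : ℝ) ≤ 216 * (32 * (8 * K + 18) + K + 2) * r * (N / ‖toE m‖) := by
  have hM := one_le_norm_toE hm0
  rcases S.eq_empty_or_nonempty with rfl | ⟨n₀, hn₀⟩
  · simp only [Finset.card_empty, Nat.cast_zero]; positivity
  set H : ℝ := 32 * (8 * K + 18) with hH
  set e : EuclideanSpace ℝ (Fin 3) := ‖toE m‖⁻¹ • toE m with he
  have he1 : ‖e‖ = 1 := by
    rw [he, norm_smul, norm_inv, norm_norm, inv_mul_cancel₀ (by linarith)]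
  set h₀ : ℝ := (H + K + 2) * (N / ‖toE m‖) with hh₀
  have hh1 : 1 ≤ h₀ := by
    rw [hh₀, ← mul_div_assoc, one_le_div (by linarith)]
    nlinarith
  have hV : 1 ≤ N ^ (α - 1) := Real.one_le_rpow hN (by linarith)
  have hjbl : ∀ n ∈ S, jb (n + m) ≤ (K + 2) * N := by
    intro n hn
    have := jb_add_le n m
    have := (hS n hn).1.2
    linarith
  have hvar : ∀ n ∈ S, ∀ n' ∈ S, jb n' ≤ jb n → jb n ^ 2 - jb n' ^ 2 ≤ H * N := by
    have hup : ∀ n ∈ S, ∀ n' ∈ S, jbb α (n + m) - jbb α (n' + m) ≤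
        8 * (K + 2) * N ^ (α - 1) := by
      intro n hn n' hn'
      obtain ⟨-, h1, -⟩ := hS n hn
      obtain ⟨-, h2, -⟩ := hS n' hn'
      have hpow : jb (n + m) ^ (α - 1) ≤ (K + 2) * N ^ (α - 1) := by
        calc jb (n + m) ^ (α - 1) ≤ ((K + 2) * N) ^ (α - 1) :=
              Real.rpow_le_rpow (by linarith) (hjbl n hn) (by linarith)
          _ = (K + 2) ^ (α - 1) * N ^ (α - 1) := Real.mul_rpow (by linarith) (by linarith)
          _ ≤ (K + 2) ^ (1 : ℝ) * N ^ (α - 1) := by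
              gcongr <;> linarith
          _ = _ := by rw [Real.rpow_one]
      rcases le_total (jb (n' + m)) (jb (n + m)) with hle | hle
      · have := jbb_sub_le hα hα' hle (by linarith)
        linarith
      · have h3 : jbb α (n + m) ≤ jbb α (n' + m) := by
          unfold jbb
          apply Real.sqrt_le_sqrt
          have := Real.rpow_le_rpow (z := 2 * α) (by linarith) hle (by linarith)
          linarith
        have : 0 ≤ 8 * (K + 2) * N ^ (α - 1) := by positivity
        linarith
    intro n hn n' hn' hle
    have h1 : |jbb α (n + m) - jbb α (n' + m)| ≤ 8 * (K + 2) * N ^ (α - 1) := by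
      rw [abs_le]
      constructor
      · linarith [hup n' hn' n hn]
      · exact hup n hn n' hn'
    have h2 := abs_sub_le_of_isSign hσ hτ (hS n hn).2.2 (hS n' hn').2.2 h1
    have h3 := (le_abs_self _).trans h2
    exact jb_sq_sub_le hα hα' hN (by linarith) (hS n' hn').1.1 hle (hS n hn).1.2 (by nlinarith)
  have hin : ∀ n ∈ S, |inner ℝ e (toE (n + m)) - inner ℝ e (toE (n₀ + m))| ≤ h₀ := by
    intro n hn
    have h1 : |jb n ^ 2 - jb n₀ ^ 2| ≤ H * N := by
      have hHN : 0 ≤ H * N := by positivity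
      rcases le_total (jb n₀) (jb n) with hle | hle
      · rw [abs_of_nonneg (by nlinarith [one_le_jb n₀])]; exact hvar n hn n₀ hn₀ hle
      · rw [abs_sub_comm, abs_of_nonneg (by nlinarith [one_le_jb n])]
        exact hvar n₀ hn₀ n hn hle
    have h2 : |jb (n + m) ^ 2 - jb (n₀ + m) ^ 2| ≤ 2 * (K + 2) * N := by
      have e1 := (hS n hn).2.1
      have e2 := (hS n₀ hn₀).2.1
      have e3 := hjbl n hn
      have e4 := hjbl n₀ hn₀
      rw [sq_sub_sq, abs_mul, abs_of_nonneg (by linarith)]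
      have e5 : |jb (n + m) - jb (n₀ + m)| ≤ 1 := by rw [abs_le]; constructor <;> linarith
      nlinarith [abs_nonneg (jb (n + m) - jb (n₀ + m))]
    have hexp : ∀ n : Fin 3 → ℤ, jb n ^ 2 = jb (n + m) ^ 2 - 2 * inner ℝ (toE m) (toE (n + m))
        + ‖toE m‖ ^ 2 := by
      intro n
      have : toE n = toE (n + m) - toE m := by rw [toE_add]; simp
      rw [jb_sq, jb_sq, this, norm_sub_sq_real, real_inner_comm]
      ring
    have h3 : |inner ℝ (toE m) (toE (n + m)) - inner ℝ (toE m) (toE (n₀ + m))|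
        ≤ (H + K + 2) * N := by
      have e1 := hexp n
      have e2 := hexp n₀
      have hHN : 0 ≤ H * N := by positivity
      rw [abs_le] at *
      constructor <;> linarith [h1.1, h1.2, h2.1, h2.2]
    rw [he, real_inner_smul_left, real_inner_smul_left, ← mul_sub, abs_mul,
      abs_of_nonneg (by positivity), hh₀, inv_mul_le_iff₀ (by linarith)]
    calc _ ≤ _ := h3
      _ = _ := by field_simp
  have hcard := card_shell_inter_slab_le (S.image (· + m)) e he1 r
    (inner ℝ e (toE (n₀ + m)) - h₀) (2 * h₀) hr (by linarith) (by
      intro l hl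
      obtain ⟨n, hn, rfl⟩ := Finset.mem_image.mp hl
      refine ⟨(hS n hn).2.1, ?_⟩
      have := abs_le.mp (hin n hn)
      constructor <;> linarith [this.1, this.2])
  rw [Finset.card_image_of_injective _ (add_left_injective m)] at hcard
  calc _ ≤ _ := hcard
    _ = _ := by rw [hh₀]; ring

theorem card_shell_le {r : ℝ} (hr : 1 ≤ r) (c : Fin 3 → ℤ) (S : Finset (Fin 3 → ℤ))
    (hS : ∀ n ∈ S, r ≤ jb (n + c) ∧ jb (n + c) ≤ r + 1) :
    (S.card : ℝ) ≤ 432 * r ^ 2 := by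
  have he1 : ‖(EuclideanSpace.single 0 1 : EuclideanSpace ℝ (Fin 3))‖ = 1 := by simp
  have hcard := card_shell_inter_slab_le (S.image (· + c)) (EuclideanSpace.single 0 1) he1 r
    (-(r + 1)) (2 * (r + 1)) hr (by linarith) (by
      intro l hl
      obtain ⟨n, hn, rfl⟩ := Finset.mem_image.mp hl
      refine ⟨hS n hn, ?_⟩
      have h1 := abs_real_inner_le_norm (EuclideanSpace.single 0 1) (toE (n + c))
      rw [he1, one_mul] at h1
      have h2 := abs_le.mp h1
      have := norm_toE_le_jb (n + c)
      have := (hS n hn).2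
      constructor <;> linarith [h2.1, h2.2])
  rw [Finset.card_image_of_injective _ (add_left_injective c)] at hcard
  nlinarith

/-- Summation over the unit-width shells of `v`. -/
theorem sum_le_sum_shells {ι : Type*} (S : Finset ι) (v w : ι → ℝ) (I : Finset ℕ) (c g : ℕ → ℝ)
    (hI : ∀ n ∈ S, ⌊v n⌋₊ ∈ I)
    (hcard : ∀ r ∈ I, ((S.filter (fun n => ⌊v n⌋₊ = r)).card : ℝ) ≤ c r)
    (hw : ∀ n ∈ S, w n ≤ g ⌊v n⌋₊) (hg : ∀ r ∈ I, 0 ≤ g r) :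
    ∑ n ∈ S, w n ≤ ∑ r ∈ I, c r * g r := by
  rw [← Finset.sum_fiberwise_of_maps_to hI]
  apply Finset.sum_le_sum
  intro r hr
  calc ∑ n ∈ S with ⌊v n⌋₊ = r, w n ≤ ∑ n ∈ S with ⌊v n⌋₊ = r, g r := by
        apply Finset.sum_le_sum
        intro n hn
        rw [Finset.mem_filter] at hn
        rw [← hn.2]; exact hw n hn.1
    _ = ((S.filter (fun n => ⌊v n⌋₊ = r)).card : ℝ) * g r := by simp
    _ ≤ _ := mul_le_mul_of_nonneg_right (hcard r hr) (hg r hr)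

theorem floor_jb_mem {v R : ℝ} (hv : 1 ≤ v) (hR : v ≤ R) : ⌊v⌋₊ ∈ Finset.Icc 1 ⌊R⌋₊ := by
  rw [Finset.mem_Icc]
  exact ⟨Nat.one_le_floor_iff v |>.mpr hv, Nat.floor_le_floor hR⟩

theorem sum_shell_weights_le {R b : ℝ} (hR : 0 ≤ R) (f : ℕ → ℝ) (hb : 0 ≤ b)
    (h : ∀ r ∈ Finset.Icc 1 ⌊R⌋₊, f r ≤ b) : ∑ r ∈ Finset.Icc 1 ⌊R⌋₊, f r ≤ R * b := by
  calc _ ≤ ∑ r ∈ Finset.Icc 1 ⌊R⌋₊, b := Finset.sum_le_sum h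
    _ = (⌊R⌋₊ : ℝ) * b := by simp
    _ ≤ R * b := by gcongr; exact Nat.floor_le hR

/-- Weighted lattice points on a level set of the two-centre phase. -/
theorem sum_level_le {α K x : ℝ} (hα : 1 < α) (hα' : α ≤ 2) (hK : 0 ≤ K) (hx0 : 0 ≤ x)
    (hx : x < 1) :
    ∃ C : ℝ, 0 < C ∧ ∀ N : ℝ, 1 ≤ N → ∀ σ τ ζ : ℝ, IsSign σ → IsSign τ →
      ∀ m : Fin 3 → ℤ, ‖toE m‖ ≤ K * N → ∀ S : Finset (Fin 3 → ℤ),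
      (∀ n ∈ S, (N / 2 ≤ jb n ∧ jb n ≤ 2 * N) ∧
        |σ * jbb α (n + m) + τ * jbb α n - ζ| ≤ 1) →
      ∑ n ∈ S, (jb (n + m) ^ 2)⁻¹ ≤ C * N * jb m ^ (-x) := by
  set c₀ : ℝ := 216 * (32 * (8 * K + 18) + K + 2) with hc₀
  have hc₀pos : 0 < c₀ := by positivity
  have hδ : 0 < 1 - x := by linarith
  refine ⟨432 * (K + 2) + 16 * c₀ * (K + 2) + 8 * c₀ * (1 + 1 / (1 - x)) * (K + 2),
    by positivity, ?_⟩
  intro N hN σ τ ζ hσ hτ m hm S hS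
  have hJ := one_le_jb m
  have hJx : 0 < jb m ^ (-x) := Real.rpow_pos_of_pos (by linarith) _
  have hR0 : 0 ≤ (K + 2) * N := by positivity
  have hjbl : ∀ n ∈ S, jb (n + m) ≤ (K + 2) * N := by
    intro n hn
    have := jb_add_le n m
    have := (hS n hn).1.2
    linarith
  have hI : ∀ n ∈ S, ⌊jb (n + m)⌋₊ ∈ Finset.Icc 1 ⌊(K + 2) * N⌋₊ :=
    fun n hn => floor_jb_mem (one_le_jb _) (hjbl n hn)
  have hfl : ∀ n : Fin 3 → ℤ, (⌊jb (n + m)⌋₊ : ℝ) ≤ jb (n + m) ∧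
      jb (n + m) ≤ (⌊jb (n + m)⌋₊ : ℝ) + 1 ∧ (1 : ℝ) ≤ (⌊jb (n + m)⌋₊ : ℝ) := by
    intro n
    have h1 := one_le_jb (n + m)
    refine ⟨Nat.floor_le (by linarith), (Nat.lt_floor_add_one _).le, ?_⟩
    exact_mod_cast Nat.one_le_floor_iff _ |>.mpr h1
  have hw : ∀ n ∈ S, (jb (n + m) ^ 2)⁻¹ ≤ ((⌊jb (n + m)⌋₊ : ℝ) ^ 2)⁻¹ := by
    intro n _
    obtain ⟨h1, -, h3⟩ := hfl n
    gcongr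
  by_cases hm0 : m = 0
  · have hj1 : jb m = 1 := by subst hm0; simp [jb]
    have h1 := sum_le_sum_shells S (fun n => jb (n + m)) (fun n => (jb (n + m) ^ 2)⁻¹)
      (Finset.Icc 1 ⌊(K + 2) * N⌋₊) (fun r => 432 * (r : ℝ) ^ 2) (fun r => ((r : ℝ) ^ 2)⁻¹) hI
      (by
        intro r hr
        have hr1 : (1 : ℝ) ≤ r := by exact_mod_cast (Finset.mem_Icc.mp hr).1
        apply card_shell_le hr1 m
        intro n hn
        rw [Finset.mem_filter] at hn
        rw [← hn.2]
        exact ⟨(hfl n).1, (hfl n).2.1⟩)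
      hw (fun r _ => by positivity)
    have h2 := sum_shell_weights_le hR0 (fun r => 432 * (r : ℝ) ^ 2 * ((r : ℝ) ^ 2)⁻¹)
      (b := 432) (by norm_num) (by
        intro r hr
        have hr1 : (1 : ℝ) ≤ r := by exact_mod_cast (Finset.mem_Icc.mp hr).1
        rw [mul_assoc, mul_inv_cancel₀ (by positivity), mul_one])
    refine (h1.trans h2).trans ?_
    rw [hj1, Real.one_rpow, mul_one]
    have : 0 ≤ (16 * c₀ * (K + 2) + 8 * c₀ * (1 + 1 / (1 - x)) * (K + 2)) * N := by positivity
    linarith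
  have hM := one_le_norm_toE hm0
  have hJM : jb m ≤ 2 * ‖toE m‖ := by linarith [jb_le_one_add_norm m]
  have hMinv : 1 / ‖toE m‖ ≤ 2 * (jb m)⁻¹ := by
    rw [← div_eq_mul_inv, div_le_div_iff₀ (by linarith) (by linarith)]
    linarith
  have h1 := sum_le_sum_shells S (fun n => jb (n + m)) (fun n => (jb (n + m) ^ 2)⁻¹)
      ((Finset.Icc 1 ⌊(K + 2) * N⌋₊).filter (fun r => ∃ n ∈ S, ⌊jb (n + m)⌋₊ = r))
      (fun r => c₀ * (r : ℝ) * (N / ‖toE m‖)) (fun r => ((r : ℝ) ^ 2)⁻¹)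
      (fun n hn => Finset.mem_filter.mpr ⟨hI n hn, n, hn, rfl⟩)
      (by
        intro r hr
        have hr1 : (1 : ℝ) ≤ r := by
          exact_mod_cast (Finset.mem_Icc.mp (Finset.mem_filter.mp hr).1).1
        apply card_shell_inter_level_le hα hα' hK hN hr1 hσ hτ (ζ := ζ) hm0 hm
        intro n hn
        rw [Finset.mem_filter] at hn
        refine ⟨(hS n hn.1).1, ?_, (hS n hn.1).2⟩
        rw [← hn.2]
        exact ⟨(hfl n).1, (hfl n).2.1⟩)
      hw (fun r _ => by positivity)
  refine h1.trans ?_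
  rcases le_total ‖toE m‖ (N / 4) with hsmall | hlarge
  · have hterm : ∀ r ∈ (Finset.Icc 1 ⌊(K + 2) * N⌋₊).filter (fun r => ∃ n ∈ S, ⌊jb (n + m)⌋₊ = r),
        c₀ * (r : ℝ) * (N / ‖toE m‖) * ((r : ℝ) ^ 2)⁻¹ ≤ 8 * c₀ * (1 / ‖toE m‖) := by
      intro r hr
      obtain ⟨hr, n, hn, hnr⟩ := Finset.mem_filter.mp hr
      have hr1 : (1 : ℝ) ≤ r := by exact_mod_cast (Finset.mem_Icc.mp hr).1
      have h2 : jb n ≤ jb (n + m) + ‖toE m‖ := by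
        have := jb_add_le (n + m) (-m)
        have hneg : ‖toE (-m)‖ = ‖toE m‖ := by
          rw [← norm_neg (toE m)]; congr 1; ext i; simp [toE]
        rwa [add_neg_cancel_right, hneg] at this
      have h3 := (hS n hn).1.1
      have h4 := (hfl n).2.1
      rw [hnr] at h4
      have h5 : N ≤ 8 * r := by linarith
      have h6 : c₀ * (r : ℝ) * (N / ‖toE m‖) * ((r : ℝ) ^ 2)⁻¹
          = c₀ * (N / r) * (1 / ‖toE m‖) := by field_simp
      rw [h6]
      have h7 : N / r ≤ 8 := by rw [div_le_iff₀ (by linarith)]; exact h5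
      calc c₀ * (N / r) * (1 / ‖toE m‖) ≤ c₀ * 8 * (1 / ‖toE m‖) := by gcongr
        _ = _ := by ring
    calc _ ≤ ∑ r ∈ (Finset.Icc 1 ⌊(K + 2) * N⌋₊).filter (fun r => ∃ n ∈ S, ⌊jb (n + m)⌋₊ = r),
          8 * c₀ * (1 / ‖toE m‖) := Finset.sum_le_sum hterm
      _ ≤ ∑ r ∈ Finset.Icc 1 ⌊(K + 2) * N⌋₊, 8 * c₀ * (1 / ‖toE m‖) :=
          Finset.sum_le_sum_of_subset_of_nonneg (Finset.filter_subset _ _)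
            (fun _ _ _ => by positivity)
      _ ≤ (K + 2) * N * (8 * c₀ * (1 / ‖toE m‖)) :=
          sum_shell_weights_le hR0 _ (by positivity) (fun _ _ => le_rfl)
      _ ≤ (K + 2) * N * (8 * c₀ * (2 * jb m ^ (-x))) := by
          have : (jb m)⁻¹ ≤ jb m ^ (-x) := by
            rw [← Real.rpow_neg_one]
            exact Real.rpow_le_rpow_of_exponent_le hJ (by linarith)
          gcongr
          linarith
      _ ≤ _ := by
          have : 0 ≤ (432 * (K + 2) + 8 * c₀ * (1 + 1 / (1 - x)) * (K + 2)) * (N * jb m ^ (-x)) := by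
            positivity
          linarith
  · set R := ⌊(K + 2) * N⌋₊ with hR
    have hR1 : 1 ≤ R := by
      rw [hR]; exact (Nat.one_le_floor_iff _).mpr (by nlinarith)
    have hR1' : (1 : ℝ) ≤ R := by exact_mod_cast hR1
    have hRle : (R : ℝ) ≤ 4 * (K + 2) * jb m := by
      calc (R : ℝ) ≤ (K + 2) * N := Nat.floor_le hR0
        _ ≤ (K + 2) * (4 * jb m) := by
          gcongr
          linarith [norm_toE_le_jb m]
        _ = _ := by ring
    have hharm : ∑ r ∈ Finset.Icc 1 R, (r : ℝ)⁻¹ ≤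
        (1 + 1 / (1 - x)) * (4 * (K + 2) * jb m ^ (1 - x)) := by
      have e1 : ∑ r ∈ Finset.Icc 1 R, (r : ℝ)⁻¹ ≤ 1 + Real.log R := by
        have := harmonic_le_one_add_log R
        rw [harmonic_eq_sum_Icc] at this
        push_cast at this
        exact this
      have e2 := Real.log_le_rpow_div (x := (R : ℝ)) (by positivity) hδ
      have e3 : (1 : ℝ) ≤ (R : ℝ) ^ (1 - x) := Real.one_le_rpow hR1' hδ.le
      have e4 : (R : ℝ) ^ (1 - x) ≤ 4 * (K + 2) * jb m ^ (1 - x) := by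
        calc (R : ℝ) ^ (1 - x) ≤ (4 * (K + 2) * jb m) ^ (1 - x) :=
              Real.rpow_le_rpow (by positivity) hRle hδ.le
          _ = (4 * (K + 2)) ^ (1 - x) * jb m ^ (1 - x) :=
              Real.mul_rpow (by positivity) (by linarith)
          _ ≤ (4 * (K + 2)) ^ (1 : ℝ) * jb m ^ (1 - x) := by
              gcongr <;> linarith
          _ = _ := by rw [Real.rpow_one]
      calc _ ≤ (R : ℝ) ^ (1 - x) + (R : ℝ) ^ (1 - x) / (1 - x) := by linarith
        _ = (1 + 1 / (1 - x)) * (R : ℝ) ^ (1 - x) := by ring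
        _ ≤ _ := by gcongr
    calc _ ≤ ∑ r ∈ Finset.Icc 1 R, c₀ * (r : ℝ) * (N / ‖toE m‖) * ((r : ℝ) ^ 2)⁻¹ :=
          Finset.sum_le_sum_of_subset_of_nonneg (Finset.filter_subset _ _)
            (fun _ _ _ => by positivity)
      _ = c₀ * N * (1 / ‖toE m‖) * ∑ r ∈ Finset.Icc 1 R, (r : ℝ)⁻¹ := by
          rw [Finset.mul_sum]
          apply Finset.sum_congr rfl
          intro r hr
          have hr1 : (1 : ℝ) ≤ r := by exact_mod_cast (Finset.mem_Icc.mp hr).1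
          field_simp
      _ ≤ c₀ * N * (2 * (jb m)⁻¹) * ((1 + 1 / (1 - x)) * (4 * (K + 2) * jb m ^ (1 - x))) := by
          gcongr
      _ = 8 * c₀ * (1 + 1 / (1 - x)) * (K + 2) * N * jb m ^ (-x) := by
          have : jb m ^ (-x) = (jb m)⁻¹ * jb m ^ (1 - x) := by
            rw [← Real.rpow_neg_one, ← Real.rpow_add (by linarith)]; congr 1; ring
          rw [this]; ring
      _ ≤ _ := by
          have : 0 ≤ (432 * (K + 2) + 16 * c₀ * (K + 2)) * (N * jb m ^ (-x)) := by
            positivity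
          linarith

/-- Lattice sums of `⟨n + c⟩^{-x}` over a shell-bounded region, uniformly in the shift. -/
theorem sum_jb_rpow_neg_le {x : ℝ} (hx0 : 0 ≤ x) (hx : x ≤ 2) {R : ℝ} (hR : 0 < R)
    (c : Fin 3 → ℤ) (S : Finset (Fin 3 → ℤ)) (hS : ∀ n ∈ S, jb (n + c) ≤ R) :
    ∑ n ∈ S, jb (n + c) ^ (-x) ≤ 432 * R ^ (3 - x) := by
  have h1 := sum_le_sum_shells S (fun n => jb (n + c)) (fun n => jb (n + c) ^ (-x))
      (Finset.Icc 1 ⌊R⌋₊) (fun r => 432 * (r : ℝ) ^ 2) (fun r => (r : ℝ) ^ (-x))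
      (fun n hn => floor_jb_mem (one_le_jb _) (hS n hn))
      (by
        intro r hr
        have hr1 : (1 : ℝ) ≤ r := by exact_mod_cast (Finset.mem_Icc.mp hr).1
        apply card_shell_le hr1 c
        intro n hn
        rw [Finset.mem_filter] at hn
        rw [← hn.2]
        exact ⟨Nat.floor_le (by linarith [one_le_jb (n + c)]), (Nat.lt_floor_add_one _).le⟩)
      (by
        intro n _
        have h := one_le_jb (n + c)
        have h' : (1 : ℝ) ≤ (⌊jb (n + c)⌋₊ : ℝ) := by
          exact_mod_cast Nat.one_le_floor_iff _ |>.mpr h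
        exact Real.rpow_le_rpow_of_nonpos (by linarith) (Nat.floor_le (by linarith)) (by linarith))
      (fun r _ => by positivity)
  have h2 := sum_shell_weights_le hR.le (fun r => 432 * (r : ℝ) ^ 2 * (r : ℝ) ^ (-x))
    (b := 432 * R ^ (2 - x)) (by positivity) (by
      intro r hr
      obtain ⟨hr1, hr2⟩ := Finset.mem_Icc.mp hr
      have hr1 : (1 : ℝ) ≤ r := by exact_mod_cast hr1
      have hrR : (r : ℝ) ≤ R := by
        calc (r : ℝ) ≤ (⌊R⌋₊ : ℝ) := by exact_mod_cast hr2
          _ ≤ R := Nat.floor_le hR.le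
      have : (r : ℝ) ^ 2 * (r : ℝ) ^ (-x) = (r : ℝ) ^ (2 - x) := by
        rw [← Real.rpow_natCast, ← Real.rpow_add (by linarith)]; congr 1
      rw [mul_assoc, this]
      gcongr)
  refine (h1.trans h2).trans (le_of_eq ?_)
  rw [show 3 - x = (2 - x) + 1 by ring, Real.rpow_add_one hR.ne']
  ring

theorem sum_jb_shift_rpow_neg_le {x : ℝ} (hx0 : 0 ≤ x) (hx : x ≤ 2) {N : ℝ} (hN : 1 ≤ N)
    (c : Fin 3 → ℤ) (S : Finset (Fin 3 → ℤ)) (hS : ∀ n ∈ S, jb n ≤ 2 * N) :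
    ∑ n ∈ S, jb (n + c) ^ (-x) ≤ 3888 * N ^ (3 - x) := by
  rw [← Finset.sum_filter_add_sum_filter_not S (fun n => jb (n + c) ≤ N)]
  have h1 := sum_jb_rpow_neg_le hx0 hx (R := N) (by linarith) c
    (S.filter (fun n => jb (n + c) ≤ N)) (fun n hn => (Finset.mem_filter.mp hn).2)
  have h2 : ∑ n ∈ S with ¬ jb (n + c) ≤ N, jb (n + c) ^ (-x) ≤ 3456 * N ^ (3 - x) := by
    have hcard : (S.card : ℝ) ≤ 3456 * N ^ 3 := by
      have := sum_jb_rpow_neg_le le_rfl (by norm_num : (0 : ℝ) ≤ 2) (R := 2 * N) (by linarith) 0 S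
        (by simpa using hS)
      simp only [neg_zero, Real.rpow_zero, Finset.sum_const, nsmul_eq_mul, mul_one, sub_zero] at this
      rw [show (3 : ℝ) = ((3 : ℕ) : ℝ) by norm_num, Real.rpow_natCast] at this
      linarith
    calc _ ≤ ∑ n ∈ S with ¬ jb (n + c) ≤ N, N ^ (-x) := by
          apply Finset.sum_le_sum
          intro n hn
          have := (Finset.mem_filter.mp hn).2
          exact Real.rpow_le_rpow_of_nonpos (by linarith) (by linarith) (by linarith)
      _ ≤ ∑ n ∈ S, N ^ (-x) := Finset.sum_le_sum_of_subset_of_nonneg (Finset.filter_subset _ _)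
            (fun _ _ _ => by positivity)
      _ = S.card * N ^ (-x) := by simp
      _ ≤ 3456 * N ^ 3 * N ^ (-x) := by gcongr
      _ = _ := by
          rw [mul_assoc, ← Real.rpow_natCast, ← Real.rpow_add (by linarith)]; congr 1
  linarith

theorem ind_of_true {p : Prop} (h : p) : ind p = 1 := by simp [ind, h]

theorem ind_of_false {p : Prop} (h : ¬ p) : ind p = 0 := by simp [ind, h]

theorem ind_nonneg (p : Prop) : 0 ≤ ind p := by unfold ind; split_ifs <;> norm_num

theorem SimFreq.norm_le {N : ℝ} (hN : 1 ≤ N) {n : Fin 3 → ℤ} (h : SimFreq N n) : ‖toE n‖ ≤ N := by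
  rw [← znorm_eq_norm]
  rcases h with h | h
  · exact h.2.2
  · exact h.2.trans hN

theorem SimFreq.jb_bounds {N : ℝ} (hN : 1 ≤ N) {n : Fin 3 → ℤ} (h : SimFreq N n) :
    N / 2 ≤ jb n ∧ jb n ≤ 2 * N := by
  refine ⟨?_, by linarith [jb_le_one_add_norm n, h.norm_le hN]⟩
  rcases h with h | h
  · have := norm_toE_le_jb n
    rw [← znorm_eq_norm] at this
    linarith [h.2.1]
  · linarith [one_le_jb n, h.1]

/-- The localized weight `1_{|n| ∼ N} ⟪n⟫⁻²`. -/
def freqWeight (α N : ℝ) (n : Fin 3 → ℤ) : ℝ := ind (SimFreq N n) * jbb α n ^ (-2 : ℝ)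

theorem freqWeight_nonneg (α N : ℝ) (n : Fin 3 → ℤ) : 0 ≤ freqWeight α N n :=
  mul_nonneg (ind_nonneg _) (Real.rpow_nonneg (jbb_nonneg α n) _)

theorem freqWeight_eq_zero {α N : ℝ} {n : Fin 3 → ℤ} (h : ¬ SimFreq N n) :
    freqWeight α N n = 0 := by
  rw [freqWeight, ind_of_false h, zero_mul]

theorem freqWeight_le {α N : ℝ} (hα : 1 < α) (hα' : α ≤ 2) (hN : 1 ≤ N) (n : Fin 3 → ℤ) :
    freqWeight α N n ≤ 64 * N ^ (-(2 * α)) := by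
  by_cases h : SimFreq N n
  swap
  · rw [freqWeight_eq_zero h]; positivity
  rw [freqWeight, ind_of_true h, one_mul]
  have hb := (h.jb_bounds hN).1
  have h1 := one_le_jb n
  have h2 := (jbb_bounds hα n).1
  rw [← Real.rpow_add_one (by linarith), sub_add_cancel] at h2
  have h3 : (N / 2) ^ α ≤ jb n ^ α := Real.rpow_le_rpow (by linarith) hb (by linarith)
  have h4 : N ^ α / 4 ≤ (N / 2) ^ α := by
    rw [Real.div_rpow (by linarith) (by norm_num)]
    gcongr
    calc (2 : ℝ) ^ α ≤ 2 ^ (2 : ℝ) := Real.rpow_le_rpow_of_exponent_le (by norm_num) hα'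
      _ = 4 := by norm_num
  have h5 : N ^ α / 8 ≤ jbb α n := by linarith
  have hpos : 0 < N ^ α := by positivity
  calc jbb α n ^ (-2 : ℝ) ≤ (N ^ α / 8) ^ (-2 : ℝ) :=
        Real.rpow_le_rpow_of_nonpos (by positivity) h5 (by norm_num)
    _ = 64 * N ^ (-(2 * α)) := by
        rw [Real.div_rpow (by positivity) (by norm_num), ← Real.rpow_mul (by linarith),
          show α * -2 = -(2 * α) by ring, Real.rpow_neg (by norm_num : (0 : ℝ) ≤ 8)]
        norm_num
        ring

theorem sum_freqWeight_shift_le {α N x : ℝ} (hα : 1 < α) (hα' : α ≤ 2) (hN : 1 ≤ N)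
    (hx0 : 0 ≤ x) (hx : x ≤ 2) (c : Fin 3 → ℤ) (B : Finset (Fin 3 → ℤ)) :
    ∑ n ∈ B, freqWeight α N n * jb (n + c) ^ (-x) ≤ 248832 * N ^ (3 - x - 2 * α) := by
  classical
  have hpos : 0 < N ^ (-(2 * α)) := by positivity
  have hj : ∀ n, 0 ≤ jb (n + c) ^ (-x) := fun n =>
    Real.rpow_nonneg (by linarith [one_le_jb (n + c)]) _
  calc ∑ n ∈ B, freqWeight α N n * jb (n + c) ^ (-x)
      = ∑ n ∈ B with SimFreq N n, freqWeight α N n * jb (n + c) ^ (-x) := by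
        rw [Finset.sum_filter_of_ne]
        intro n _ hne
        by_contra h
        exact hne (by rw [freqWeight_eq_zero h, zero_mul])
    _ ≤ ∑ n ∈ B with SimFreq N n, 64 * N ^ (-(2 * α)) * jb (n + c) ^ (-x) :=
        Finset.sum_le_sum fun n _ =>
          mul_le_mul_of_nonneg_right (freqWeight_le hα hα' hN n) (hj n)
    _ = 64 * N ^ (-(2 * α)) * ∑ n ∈ B with SimFreq N n, jb (n + c) ^ (-x) := by
        rw [Finset.mul_sum]
    _ ≤ 64 * N ^ (-(2 * α)) * (3888 * N ^ (3 - x)) := by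
        gcongr
        exact sum_jb_shift_rpow_neg_le hx0 hx hN c _
          (fun n hn => ((Finset.mem_filter.mp hn).2.jb_bounds hN).2)
    _ = _ := by
        rw [sub_eq_add_neg (3 - x), Real.rpow_add (by linarith)]; ring

/-- Summation over the highest frequency, the others being fixed. -/
theorem sum_freqWeight_level_le {α β K x : ℝ} (hα : 1 < α) (hα' : α ≤ 2) (hβ : -2 ≤ β)
    (hK : 0 ≤ K) (hx0 : 0 ≤ x) (hx : x < 1) :
    ∃ C : ℝ, 0 < C ∧ ∀ N : ℝ, 1 ≤ N → ∀ σ τ ζ : ℝ, IsSign σ → IsSign τ →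
      ∀ m : Fin 3 → ℤ, ‖toE m‖ ≤ K * N → ∀ B : Finset (Fin 3 → ℤ),
      ∑ n ∈ B, freqWeight α N n * (jb (n + m) ^ β *
        ind (|σ * jbb α (n + m) + τ * jbb α n - ζ| ≤ 1)) ≤
        C * N ^ (β - 2 * α + 3) * jb m ^ (-x) := by
  classical
  obtain ⟨C, hC, hmain⟩ := sum_level_le (x := x) hα hα' hK hx0 hx
  refine ⟨64 * (K + 2) ^ (β + 2) * C, by positivity, ?_⟩
  intro N hN σ τ ζ hσ hτ m hm B
  set S := B.filter (fun n => SimFreq N n ∧ |σ * jbb α (n + m) + τ * jbb α n - ζ| ≤ 1) with hSdef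
  have hS : ∀ n ∈ S, (N / 2 ≤ jb n ∧ jb n ≤ 2 * N) ∧
      |σ * jbb α (n + m) + τ * jbb α n - ζ| ≤ 1 := by
    intro n hn
    obtain ⟨-, h1, h2⟩ := Finset.mem_filter.mp hn
    exact ⟨h1.jb_bounds hN, h2⟩
  calc _ = ∑ n ∈ S, freqWeight α N n * (jb (n + m) ^ β *
        ind (|σ * jbb α (n + m) + τ * jbb α n - ζ| ≤ 1)) := by
        rw [hSdef, Finset.sum_filter_of_ne]
        intro n _ hne
        by_contra h
        apply hne
        rw [not_and_or] at h
        rcases h with h | h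
        · rw [freqWeight_eq_zero h, zero_mul]
        · rw [ind_of_false h, mul_zero, mul_zero]
    _ ≤ ∑ n ∈ S, 64 * N ^ (-(2 * α)) * (((K + 2) * N) ^ (β + 2) * (jb (n + m) ^ 2)⁻¹) := by
        apply Finset.sum_le_sum
        intro n hn
        have h1 := one_le_jb (n + m)
        have h2 : jb (n + m) ≤ (K + 2) * N := by
          have := jb_add_le n m
          have := (hS n hn).1.2
          linarith
        rw [ind_of_true (hS n hn).2, mul_one]
        have h3 : jb (n + m) ^ β = jb (n + m) ^ (β + 2) * (jb (n + m) ^ 2)⁻¹ := by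
          rw [← Real.rpow_natCast, ← Real.rpow_neg (by linarith), ← Real.rpow_add (by linarith)]
          congr 1; push_cast; ring
        have h4 : jb (n + m) ^ (β + 2) ≤ ((K + 2) * N) ^ (β + 2) :=
          Real.rpow_le_rpow (by linarith) h2 (by linarith)
        rw [h3]
        apply mul_le_mul (freqWeight_le hα hα' hN n) _ (by positivity) (by positivity)
        gcongr
    _ = 64 * N ^ (-(2 * α)) * ((K + 2) * N) ^ (β + 2) * ∑ n ∈ S, (jb (n + m) ^ 2)⁻¹ := by
        rw [Finset.mul_sum]
        exact Finset.sum_congr rfl fun _ _ => by ring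
    _ ≤ 64 * N ^ (-(2 * α)) * ((K + 2) * N) ^ (β + 2) * (C * N * jb m ^ (-x)) := by
        gcongr
        exact hmain N hN σ τ ζ hσ hτ m hm S hS
    _ = _ := by
        have hpow : N ^ (β - 2 * α + 3) = N ^ (-(2 * α)) * N ^ (β + 2) * N := by
          rw [← Real.rpow_add (by linarith), ← Real.rpow_add_one (by linarith)]
          congr 1; ring
        rw [Real.mul_rpow (by linarith) (by linarith), hpow]
        ring

theorem sum_piFinset_fin_succ {k : ℕ} {A : Type*} [DecidableEq A] (B : Finset A)
    (F : (Fin (k + 1) → A) → ℝ) :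
    ∑ n ∈ Fintype.piFinset (fun _ : Fin (k + 1) => B), F n =
      ∑ a ∈ B, ∑ p ∈ Fintype.piFinset (fun _ : Fin k => B),
        F (Fin.cons (α := fun _ => A) a p) := by
  rw [← Finset.sum_product']
  refine (Finset.sum_nbij' (fun q => Fin.cons (α := fun _ => A) q.1 q.2)
    (fun n => (n 0, fun j => n j.succ)) ?_ ?_ ?_ ?_ ?_).symm
  · rintro ⟨a, p⟩ h
    simp only [Finset.mem_product, Fintype.mem_piFinset] at h ⊢
    intro j
    refine Fin.cases ?_ (fun i => ?_) j
    · simpa using h.1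
    · simpa using h.2 i
  · intro n h
    simp only [Finset.mem_product, Fintype.mem_piFinset] at h ⊢
    exact ⟨h 0, fun j => h _⟩
  · rintro ⟨a, p⟩ _
    simp
  · intro n _
    exact Fin.cons_self_tail n
  · intro _ _; rfl

/-- The summand of the counting estimate. -/
def countTerm (α β : ℝ) {k : ℕ} (εsum : ℝ) (ε : Fin k → ℝ) (Nv : Fin k → ℝ) (ζ : ℝ)
    (n : Fin k → Fin 3 → ℤ) : ℝ :=
  (∏ j, freqWeight α (Nv j) (n j)) * jb (∑ j, n j) ^ β * ind (|phase α εsum ε n - ζ| ≤ 1)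

theorem countTerm_nonneg (α β : ℝ) {k : ℕ} (εsum : ℝ) (ε Nv : Fin k → ℝ) (ζ : ℝ)
    (n : Fin k → Fin 3 → ℤ) : 0 ≤ countTerm α β εsum ε Nv ζ n :=
  mul_nonneg (mul_nonneg (Finset.prod_nonneg fun _ _ => freqWeight_nonneg _ _ _)
    (Real.rpow_nonneg (by linarith [one_le_jb (∑ j, n j)]) _)) (ind_nonneg _)

theorem norm_toE_sum_le {k : ℕ} (p : Fin k → Fin 3 → ℤ) {N : ℝ} (hp : ∀ j, ‖toE (p j)‖ ≤ N) :
    ‖toE (∑ j, p j)‖ ≤ k * N := by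
  have h : toE (∑ j, p j) = ∑ j, toE (p j) := by
    ext i; simp [toE]
  rw [h]
  calc _ ≤ ∑ j, ‖toE (p j)‖ := norm_sum_le _ _
    _ ≤ ∑ _j : Fin k, N := Finset.sum_le_sum fun j _ => hp j
    _ = k * N := by simp

/-- The counting estimate when the first frequency is the highest one. -/
theorem sum_countTerm_le (k : ℕ) {α β : ℝ} (hα₁ : 1 < α) (hα₂ : α ≤ 3 / 2) (hβ : -2 ≤ β) :
    ∃ C : ℝ, 0 < C ∧ ∀ εsum : ℝ, IsSign εsum → ∀ ε : Fin (k + 2) → ℝ, (∀ j, IsSign (ε j)) →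
      ∀ Nv : Fin (k + 2) → ℝ, (∀ j, 1 ≤ Nv j) → (∀ j, Nv j ≤ Nv 0) → ∀ ζ : ℝ,
      ∀ B : Finset (Fin 3 → ℤ),
      ∑ n ∈ Fintype.piFinset (fun _ => B), countTerm α β εsum ε Nv ζ n ≤
        C * Nv 0 ^ (k * (3 - 2 * α) + β - 2 * α + 3) := by
  have hα' : α ≤ 2 := by linarith
  have hx0 : 0 ≤ 3 - 2 * α := by linarith
  obtain ⟨C, hC, hmain⟩ := sum_freqWeight_level_le (β := β) (K := k + 1) (x := 3 - 2 * α) hα₁ hα' hβ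
    (by positivity) hx0 (by linarith)
  refine ⟨C * 248832 * 248832 ^ k, by positivity, ?_⟩
  intro εsum hεs ε hε Nv hNv hmax ζ B
  set N := Nv 0 with hN
  have hN1 : 1 ≤ N := hNv 0
  set x : ℝ := 3 - 2 * α with hx
  set W : (Fin k → Fin 3 → ℤ) → ℝ := fun p => ∏ j, freqWeight α (Nv j.succ.succ) (p j) with hW
  have hW0 : ∀ p, 0 ≤ W p := fun p => Finset.prod_nonneg fun _ _ => freqWeight_nonneg _ _ _
  have hinner : ∀ (b : Fin 3 → ℤ) (p : Fin k → Fin 3 → ℤ),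
      ∑ a ∈ B, countTerm α β εsum ε Nv ζ (Fin.cons (α := fun _ => Fin 3 → ℤ) a
        (Fin.cons (α := fun _ => Fin 3 → ℤ) b p)) ≤
      C * N ^ (β - 2 * α + 3) * (W p * (freqWeight α (Nv 1) b * jb (b + ∑ j, p j) ^ (-x))) := by
    intro b p
    set m := b + ∑ j, p j with hm
    set ζ' := ζ - ε 1 * jbb α b - ∑ j, ε j.succ.succ * jbb α (p j) with hζ'
    have heq : ∀ a, countTerm α β εsum ε Nv ζ (Fin.cons (α := fun _ => Fin 3 → ℤ) a
        (Fin.cons (α := fun _ => Fin 3 → ℤ) b p)) = W p * freqWeight α (Nv 1) b *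
        (freqWeight α N a * (jb (a + m) ^ β *
          ind (|εsum * jbb α (a + m) + ε 0 * jbb α a - ζ'| ≤ 1))) := by
      intro a
      have h1 : phase α εsum ε (Fin.cons (α := fun _ => Fin 3 → ℤ) a
          (Fin.cons (α := fun _ => Fin 3 → ℤ) b p)) - ζ =
          εsum * jbb α (a + m) + ε 0 * jbb α a - ζ' := by
        simp only [phase, Fin.sum_univ_succ (n := k + 1), Fin.sum_univ_succ (n := k),
          Fin.cons_zero, Fin.cons_succ, hζ', hm, Fin.succ_zero_eq_one]
        ring
      rw [countTerm, h1]
      simp only [Fin.sum_univ_succ (n := k + 1), Fin.sum_univ_succ (n := k),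
        Fin.prod_univ_succ (n := k + 1), Fin.prod_univ_succ (n := k),
        Fin.cons_zero, Fin.cons_succ, hm, hW, Fin.succ_zero_eq_one, hN]
      ring
    simp only [heq]
    rw [← Finset.mul_sum]
    have hfac : 0 ≤ W p * freqWeight α (Nv 1) b := mul_nonneg (hW0 p) (freqWeight_nonneg _ _ _)
    rcases hfac.eq_or_lt with h0 | h0
    · rw [← h0, zero_mul]
      have : C * N ^ (β - 2 * α + 3) * (W p * (freqWeight α (Nv 1) b * jb m ^ (-x)))
        = C * N ^ (β - 2 * α + 3) * (W p * freqWeight α (Nv 1) b * jb m ^ (-x)) := by ring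
      rw [this, ← h0]; simp
    · have hb : SimFreq (Nv 1) b := by
        by_contra h
        rw [freqWeight_eq_zero h, mul_zero] at h0
        exact lt_irrefl _ h0
      have hp : ∀ j, SimFreq (Nv j.succ.succ) (p j) := by
        intro j
        by_contra h
        have : W p = 0 := Finset.prod_eq_zero (Finset.mem_univ j) (freqWeight_eq_zero h)
        rw [this, zero_mul] at h0
        exact lt_irrefl _ h0
      have hmn : ‖toE m‖ ≤ (k + 1) * N := by
        rw [hm, toE_add]
        have h1 := norm_add_le (toE b) (toE (∑ j, p j))
        have h2 := (hb.norm_le (hNv 1)).trans (hmax 1)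
        have h3 := norm_toE_sum_le p (N := N)
          (fun j => ((hp j).norm_le (hNv _)).trans (hmax _))
        linarith
      calc _ ≤ W p * freqWeight α (Nv 1) b * (C * N ^ (β - 2 * α + 3) * jb m ^ (-x)) := by
            gcongr
            exact hmain N hN1 εsum (ε 0) ζ' hεs (hε 0) m hmn B
        _ = _ := by ring
  rw [sum_piFinset_fin_succ]
  simp only [sum_piFinset_fin_succ (k := k)]
  calc _ = ∑ p ∈ Fintype.piFinset (fun _ : Fin k => B), ∑ b ∈ B, ∑ a ∈ B,
        countTerm α β εsum ε Nv ζ (Fin.cons (α := fun _ => Fin 3 → ℤ) a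
          (Fin.cons (α := fun _ => Fin 3 → ℤ) b p)) := by
        rw [Finset.sum_comm, Finset.sum_congr rfl fun b _ => Finset.sum_comm, Finset.sum_comm]
    _ ≤ ∑ p ∈ Fintype.piFinset (fun _ : Fin k => B), ∑ b ∈ B,
        C * N ^ (β - 2 * α + 3) * (W p * (freqWeight α (Nv 1) b * jb (b + ∑ j, p j) ^ (-x))) :=
        Finset.sum_le_sum fun p _ => Finset.sum_le_sum fun b _ => hinner b p
    _ = C * N ^ (β - 2 * α + 3) * ∑ p ∈ Fintype.piFinset (fun _ : Fin k => B),
        W p * ∑ b ∈ B, freqWeight α (Nv 1) b * jb (b + ∑ j, p j) ^ (-x) := by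
        simp only [Finset.mul_sum]
    _ ≤ C * N ^ (β - 2 * α + 3) * ∑ p ∈ Fintype.piFinset (fun _ : Fin k => B), W p * 248832 := by
        gcongr with p _
        · exact hW0 p
        · have := sum_freqWeight_shift_le hα₁ hα' (hNv 1) hx0 (by linarith) (∑ j, p j) B
          rwa [show 3 - (3 - 2 * α) - 2 * α = 0 by ring, Real.rpow_zero, mul_one] at this
    _ = C * N ^ (β - 2 * α + 3) *
          ((∏ j : Fin k, ∑ b ∈ B, freqWeight α (Nv j.succ.succ) b) * 248832) := by
        rw [← Finset.sum_mul, Finset.prod_univ_sum]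
    _ ≤ C * N ^ (β - 2 * α + 3) * ((∏ _j : Fin k, 248832 * N ^ x) * 248832) := by
        gcongr with j _
        · intro j _
          exact Finset.sum_nonneg fun _ _ => freqWeight_nonneg _ _ _
        · have h1 := sum_freqWeight_shift_le hα₁ hα' (hNv j.succ.succ) le_rfl
            (by norm_num : (0 : ℝ) ≤ 2) 0 B
          simp only [neg_zero, Real.rpow_zero, mul_one, sub_zero] at h1
          refine h1.trans ?_
          gcongr
          · linarith [hNv j.succ.succ]
          · exact hmax _
    _ = _ := by
        have hpow : N ^ ((k : ℝ) * x + β - 2 * α + 3) = N ^ (β - 2 * α + 3) * (N ^ x) ^ k := by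
          rw [← Real.rpow_mul_natCast (by linarith), ← Real.rpow_add (by linarith)]
          congr 1; ring
        rw [Finset.prod_const, Finset.card_univ, Fintype.card_fin, mul_pow, hpow]
        ring

/-- **Summation counting estimate** (Lemma 3.5): for an integer `k ≥ 3`, `1 < α ≤ 3/2`
and `s ≥ α − 1` there is `C = C(k,α,s) > 0`, uniform in the choice of signs, such that
for all dyadic `N₁,…,N_k ≥ 1` and all `ζ ∈ ℝ`,
`Σ_{n₁,…,n_k} (Π_j 1_{|n_j|∼N_j} ⟪n_j⟫⁻²) ⟨Σ_j n_j⟩^{2(s−α)} 1_{|κ−ζ|≤1}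
  ≤ C · N_max^{(k−3)(3−2α)+2s−6α+6}`. -/
theorem summation_counting (k : ℕ) (hk : 3 ≤ k) (α s : ℝ)
    (hα₁ : 1 < α) (hα₂ : α ≤ 3 / 2) (hs : α - 1 ≤ s) :
    ∃ C : ℝ, 0 < C ∧
      ∀ εsum : ℝ, IsSign εsum → ∀ ε : Fin k → ℝ, (∀ j, IsSign (ε j)) →
        ∀ Nv : Fin k → ℝ, (∀ j, IsDyadic (Nv j)) → ∀ ζ : ℝ,
          (∑' n : Fin k → Fin 3 → ℤ,
              (∏ j, ind (SimFreq (Nv j) (n j)) * jbb α (n j) ^ (-2 : ℝ)) *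
                jb (∑ j, n j) ^ (2 * (s - α)) * ind (|phase α εsum ε n - ζ| ≤ 1))
            ≤ C * sSup (Set.range Nv) ^
                (((k : ℝ) - 3) * (3 - 2 * α) + 2 * s - 6 * α + 6) := by
  classical
  obtain ⟨k, rfl⟩ : ∃ q, k = q + 2 := ⟨k - 2, by omega⟩
  obtain ⟨C, hC, hmain⟩ := sum_countTerm_le k (β := 2 * (s - α)) hα₁ hα₂ (by linarith)
  refine ⟨C, hC, ?_⟩
  intro εsum hεs ε hε Nv hNv ζ
  have hN1 : ∀ j, 1 ≤ Nv j := by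
    intro j
    obtain ⟨i, hi⟩ := hNv j
    rw [hi]; exact one_le_pow₀ (by norm_num)
  obtain ⟨j₀, hj₀⟩ := Finite.exists_max Nv
  have hsup : sSup (Set.range Nv) = Nv j₀ :=
    IsGreatest.csSup_eq ⟨⟨j₀, rfl⟩, by rintro _ ⟨j, rfl⟩; exact hj₀ j⟩
  set π : Equiv.Perm (Fin (k + 2)) := Equiv.swap 0 j₀ with hπ
  have hπ0 : π 0 = j₀ := Equiv.swap_apply_left _ _
  have hπinv : ∀ j, π (π j) = j := fun j => Equiv.swap_apply_self 0 j₀ j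
  have hterm : ∀ n : Fin (k + 2) → Fin 3 → ℤ,
      countTerm α (2 * (s - α)) εsum ε Nv ζ (n ∘ π) =
        countTerm α (2 * (s - α)) εsum (ε ∘ π) (Nv ∘ π) ζ n := by
    intro n
    have h1 : ∑ j, (n ∘ π) j = ∑ j, n j := Equiv.sum_comp π n
    have h2 : ∑ j, ε j * jbb α ((n ∘ π) j) = ∑ j, (ε ∘ π) j * jbb α (n j) := by
      rw [← Equiv.sum_comp π]; simp [hπinv]
    have h3 : ∏ j, freqWeight α (Nv j) ((n ∘ π) j) = ∏ j, freqWeight α ((Nv ∘ π) j) (n j) := by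
      rw [← Equiv.prod_comp π]; simp [hπinv]
    rw [countTerm, countTerm, phase, phase, h1, h2, h3]
  change (∑' n, countTerm α (2 * (s - α)) εsum ε Nv ζ n) ≤ _
  rw [hsup, ← (Equiv.arrowCongr π (Equiv.refl (Fin 3 → ℤ))).tsum_eq]
  have hsymm : π.symm = π := Equiv.symm_swap _ _
  have hcongr : ∀ n : Fin (k + 2) → Fin 3 → ℤ,
      Equiv.arrowCongr π (Equiv.refl (Fin 3 → ℤ)) n = n ∘ π := by
    intro n; ext j; simp [Equiv.arrowCongr, hsymm]
  simp only [hcongr, hterm]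
  have hpos : 0 < Nv j₀ := by linarith [hN1 j₀]
  refine tsum_le_of_sum_le' (by positivity) ?_
  intro S
  set B : Finset (Fin 3 → ℤ) := S.biUnion (fun n => Finset.univ.image n) with hB
  have hsub : S ⊆ Fintype.piFinset (fun _ : Fin (k + 2) => B) := by
    intro n hn
    rw [Fintype.mem_piFinset]
    intro j
    exact Finset.mem_biUnion.mpr ⟨n, hn, Finset.mem_image_of_mem _ (Finset.mem_univ j)⟩
  refine (Finset.sum_le_sum_of_subset_of_nonneg hsub
    fun _ _ _ => countTerm_nonneg _ _ _ _ _ _ _).trans ?_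
  have h := hmain εsum hεs (ε ∘ π) (fun j => hε _) (Nv ∘ π) (fun j => hN1 _)
    (fun j => by simpa [hπ0] using hj₀ (π j)) ζ B
  refine h.trans (le_of_eq ?_)
  simp only [Function.comp, hπ0]
  congr 2
  push_cast
  ring
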